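/- Let k be a field of characteristic ≠ 2 and n a positive integer congruent to 2 mod 4. Then the diagonal symmetric bilinear form ⟨C(n,m) : 0 ≤ m < n/2, m even⟩ is isomorphic over k to ⟨2·C(n,n/2)⟩ ⊕ ⟨C(n,m) : 0 ≤ m < n/2, m odd⟩. -/

import Mathlib

open Polynomial in
/-- The Krawtchouk numbers `K_a(m)`. -/
noncomputable def kraw (n a m : ℕ) : ℤ := ((1 - X) ^ m * (1 + X) ^ (n - m) : ℤ[X]).coeff a

open Polynomial in
theorem swap_coeff (p : ℤ[X][X]) (i j : ℕ) :
    ((Bivariate.swap p).coeff i).coeff j = (p.coeff j).coeff i := by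
  induction p using Polynomial.induction_on' with
  | add p q hp hq => simp [hp, hq]
  | monomial m f =>
    induction f using Polynomial.induction_on' with
    | add p q hp hq => simp only [map_add, coeff_add, hp, hq]
    | monomial l r =>
      rw [Bivariate.swap_monomial_monomial]
      simp only [coeff_monomial]
      split_ifs <;> simp_all [coeff_monomial]

open Polynomial in
theorem biv_coeff (n m a : ℕ) (hm : m ≤ n) :
    (((C (1 + X) + X * C (1 - X)) ^ n : ℤ[X][X]).coeff m).coeff a = n.choose m * kraw n a m := by
  rw [add_comm, add_pow, finsetSum_coeff]
  rw [Finset.sum_eq_single m]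
  · have : (X * C (1 - X)) ^ m * C (1 + X) ^ (n - m) * ((n.choose m : ℕ) : ℤ[X][X])
        = C ((1 - X) ^ m * (1 + X) ^ (n - m) * (n.choose m : ℤ[X])) * X ^ m := by
      simp only [map_mul, map_pow, map_natCast]; ring
    rw [this, coeff_C_mul_X_pow, if_pos rfl, kraw, mul_comm, ← C_eq_natCast, coeff_C_mul]
  · intro b _ hb
    have : (X * C (1 - X)) ^ b * C (1 + X) ^ (n - b) * ((n.choose b : ℕ) : ℤ[X][X])
        = C ((1 - X) ^ b * (1 + X) ^ (n - b) * (n.choose b : ℤ[X])) * X ^ b := by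
      simp only [map_mul, map_pow, map_natCast]; ring
    rw [this, coeff_C_mul_X_pow, if_neg (Ne.symm hb)]
  · intro h; simp at h; omega

open Polynomial in
theorem kraw_symm (n m a : ℕ) (hm : m ≤ n) (ha : a ≤ n) :
    (n.choose m : ℤ) * kraw n a m = n.choose a * kraw n m a := by
  rw [← biv_coeff n m a hm, ← biv_coeff n a m ha, ← swap_coeff]
  congr 2
  rw [map_pow]
  congr 1
  simp only [map_add, map_mul, map_sub, Bivariate.swap_X, Bivariate.swap_Y, map_one]
  ring

open Polynomial in
theorem hom_step (p : ℤ[X]) (d : ℕ) (hp : p.natDegree ≤ d) (e : ℤ) (U W : ℤ[X]) :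
    ∑ m ∈ Finset.range (d + 1 + 1), C ((p * (1 + C e * X)).coeff m) * (U ^ m * W ^ (d + 1 - m))
      = (∑ m ∈ Finset.range (d + 1), C (p.coeff m) * (U ^ m * W ^ (d - m))) * (W + C e * U) := by
  have h1 : p * (1 + C e * X) = p + C e * (p * X) := by ring
  rw [h1, mul_add]
  simp only [coeff_add, coeff_C_mul, map_add, map_mul, add_mul, Finset.sum_add_distrib]
  congr 1
  · rw [Finset.sum_range_succ, coeff_eq_zero_of_natDegree_lt (n := d + 1) (by omega),
      Finset.sum_mul]
    simp only [map_zero, zero_mul, add_zero]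
    apply Finset.sum_congr rfl
    intro m hm
    have : m < d + 1 := Finset.mem_range.1 hm
    rw [show d + 1 - m = (d - m) + 1 by omega]; ring
  · rw [Finset.sum_range_succ', Finset.sum_mul]
    simp only [coeff_mul_X, coeff_mul_X_zero, map_zero, mul_zero, zero_mul, add_zero]
    apply Finset.sum_congr rfl
    intro m hm
    rw [show d + 1 - (m + 1) = d - m by omega]; ring

open Polynomial in
theorem hom_eq (a b : ℕ) (U W : ℤ[X]) :
    ((1 - X) ^ a * (1 + X) ^ b : ℤ[X]).natDegree ≤ a + b ∧
    ∑ m ∈ Finset.range (a + b + 1), C (((1 - X) ^ a * (1 + X) ^ b : ℤ[X]).coeff m) *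
      (U ^ m * W ^ (a + b - m)) = (W - U) ^ a * (W + U) ^ b := by
  constructor
  · compute_degree
  induction b with
  | zero =>
    induction a with
    | zero => simp
    | succ a ih =>
      have := hom_step ((1 - X) ^ a * (1 + X) ^ 0 : ℤ[X]) (a + 0) (by compute_degree; omega) (-1) U W
      rw [ih] at this
      have e : ((1 - X) ^ a * (1 + X) ^ 0 : ℤ[X]) * (1 + C (-1) * X) = (1 - X) ^ (a + 1) * (1 + X) ^ 0 := by
        simp; ring
      rw [e] at this
      rw [show a + 1 + 0 = a + 0 + 1 by omega, this]
      simp; ring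
  | succ b ih =>
    have := hom_step ((1 - X) ^ a * (1 + X) ^ b : ℤ[X]) (a + b) (by compute_degree) 1 U W
    rw [ih] at this
    have e : ((1 - X) ^ a * (1 + X) ^ b : ℤ[X]) * (1 + C 1 * X) = (1 - X) ^ a * (1 + X) ^ (b + 1) := by
      simp; ring
    rw [e] at this
    rw [show a + (b + 1) = a + b + 1 by omega, this]
    simp; ring

open Polynomial in
theorem kraw_sq (n a b : ℕ) (ha : a ≤ n) :
    ∑ m ∈ Finset.range (n + 1), kraw n m a * kraw n b m = if b = a then 2 ^ n else 0 := by
  have h := (hom_eq a (n - a) (1 - X) (1 + X)).2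
  have h2 : ((1 + X - (1 - X)) ^ a * (1 + X + (1 - X)) ^ (n - a) : ℤ[X]) = C (2 ^ n) * X ^ a := by
    have : (2 : ℤ[X]) ^ n = 2 ^ a * 2 ^ (n - a) := by rw [← pow_add]; congr 1; omega
    simp only [map_pow, map_ofNat]
    rw [this]; ring
  rw [h2, show a + (n - a) = n by omega] at h
  have h3 := congrArg (fun p => p.coeff b) h
  simp only [finsetSum_coeff, coeff_C_mul, coeff_X_pow] at h3
  simp only [kraw]
  rw [h3]; simp

open Polynomial in
theorem kraw_sq' (n a b : ℕ) (ha : a ≤ n) :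
    ∑ m ∈ Finset.range (n + 1), (-1) ^ m * (kraw n m a * kraw n b m)
      = if b = n - a then 2 ^ n else 0 := by
  have h := (hom_eq a (n - a) (-(1 - X)) (1 + X)).2
  have h2 : ((1 + X - -(1 - X)) ^ a * (1 + X + -(1 - X)) ^ (n - a) : ℤ[X])
      = C (2 ^ n) * X ^ (n - a) := by
    have : (2 : ℤ[X]) ^ n = 2 ^ a * 2 ^ (n - a) := by rw [← pow_add]; congr 1; omega
    simp only [map_pow, map_ofNat]
    rw [this]; ring
  rw [h2, show a + (n - a) = n by omega] at h
  have h3 := congrArg (fun p => p.coeff b) h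
  have h4 : ∀ m : ℕ, (-(1 - X) : ℤ[X]) ^ m * (1 + X) ^ (n - m)
      = C ((-1) ^ m) * ((1 - X) ^ m * (1 + X) ^ (n - m)) := by
    intro m; rw [neg_pow]; simp only [map_pow, map_neg, map_one]; ring
  simp only [finsetSum_coeff, h4, coeff_C_mul, coeff_X_pow] at h3
  simp only [kraw]
  rw [mul_ite, mul_one, mul_zero] at h3
  rw [← h3]
  apply Finset.sum_congr rfl
  intros; ring

open Polynomial in
theorem kraw_refl (n a m : ℕ) (hm : m ≤ n) : kraw n a (n - m) = (-1) ^ a * kraw n a m := by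
  simp only [kraw]
  rw [mul_comm ((-1 : ℤ) ^ a), ← comp_C_mul_X_coeff]
  congr 1
  simp only [mul_comp, pow_comp, sub_comp, add_comp, one_comp, X_comp, map_neg, map_one]
  rw [show n - (n - m) = m by omega]; ring

theorem kraw_refl' (n a m : ℕ) (hm : m ≤ n) (ha : a ≤ n) :
    kraw n (n - m) a = (-1) ^ a * kraw n m a := by
  have h1 := kraw_symm n (n - m) a (by omega) ha
  have h2 := kraw_symm n m a hm ha
  rw [kraw_refl n a m hm, Nat.choose_symm hm] at h1
  have h0 : (n.choose a : ℤ) ≠ 0 := by exact_mod_cast (Nat.choose_pos ha).ne'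
  apply mul_left_cancel₀ h0
  rw [← h1]
  linear_combination (-1) ^ a * h2

theorem sum_even (f : ℕ → ℤ) (t : ℕ) :
    ∑ m ∈ Finset.range (2 * t + 1), (f m + (-1) ^ m * f m)
      = 2 * ∑ i ∈ Finset.range (t + 1), f (2 * i) := by
  induction t with
  | zero => simp; ring
  | succ t ih =>
    rw [show 2 * (t + 1) + 1 = 2 * t + 1 + 1 + 1 by omega, Finset.sum_range_succ,
      Finset.sum_range_succ, ih, Finset.sum_range_succ _ (t + 1)]
    have h1 : (-1 : ℤ) ^ (2 * t + 1) = -1 := by rw [pow_succ, pow_mul]; simp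
    have h2 : (-1 : ℤ) ^ (2 * t + 1 + 1) = 1 := by rw [pow_succ, h1]; simp
    rw [h1, h2, show 2 * (t + 1) = 2 * t + 1 + 1 by omega]; ring

theorem sum_fold (f : ℕ → ℤ) (N : ℕ) (hf : ∀ m ≤ 4 * N + 2, f (4 * N + 2 - m) = f m) :
    ∑ m ∈ Finset.range (4 * N + 2 + 1), (f m + (-1) ^ m * f m)
      = 4 * ∑ i ∈ Finset.range (N + 1), f (2 * i) := by
  rw [show 4 * N + 2 + 1 = 2 * (2 * N + 1) + 1 by omega, sum_even,
    show 2 * N + 1 + 1 = (N + 1) + (N + 1) by omega, Finset.sum_range_add]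
  have : ∑ i ∈ Finset.range (N + 1), f (2 * (N + 1 + i)) = ∑ i ∈ Finset.range (N + 1), f (2 * i) := by
    rw [← Finset.sum_range_reflect]
    apply Finset.sum_congr rfl
    intro i hi
    have : i < N + 1 := Finset.mem_range.1 hi
    rw [← hf (2 * i) (by omega)]
    congr 1; omega
  rw [this]; ring

theorem kraw_key (N a b : ℕ) (ha : a ≤ 4 * N + 2) (oa : Odd a) (ob : Odd b) :
    ∑ i ∈ Finset.range (N + 1), kraw (4 * N + 2) (2 * i) a * kraw (4 * N + 2) b (2 * i)
      = 2 ^ (4 * N) * ((if b = a then 1 else 0) + (if b = 4 * N + 2 - a then 1 else 0)) := by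
  have h := sum_fold (fun m => kraw (4 * N + 2) m a * kraw (4 * N + 2) b m) N (by
    intro m hm
    rw [kraw_refl' _ _ _ hm ha, kraw_refl _ _ _ hm, oa.neg_one_pow, ob.neg_one_pow]; ring)
  rw [Finset.sum_add_distrib, kraw_sq _ _ _ ha, kraw_sq' _ _ _ ha] at h
  have : (2 : ℤ) ^ (4 * N + 2) = 4 * 2 ^ (4 * N) := by ring
  rw [this] at h
  have h4 : (4 : ℤ) ≠ 0 := by norm_num
  apply mul_left_cancel₀ h4
  rw [← h]
  split_ifs <;> ring

/-- The index set: `n/2` followed by the odd numbers below `n/2`. -/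
def oddIdx (N : ℕ) (j : Fin (N + 1)) : ℕ := if (j : ℕ) = 0 then 2 * N + 1 else 2 * (j : ℕ) - 1

theorem kraw_fin (N : ℕ) (j l : Fin (N + 1)) :
    ∑ i : Fin (N + 1), kraw (4 * N + 2) (2 * i) (oddIdx N j) * kraw (4 * N + 2) (oddIdx N l) (2 * i)
      = if l = j then 2 ^ (4 * N) * (if j = 0 then 2 else 1) else 0 := by
  have hj := j.2
  have hl := l.2
  have o : ∀ j, Odd (oddIdx N j) := by
    intro j
    rw [Nat.odd_iff, oddIdx]; split_ifs <;> omega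
  have ha : oddIdx N j ≤ 4 * N + 2 := by rw [oddIdx]; split_ifs <;> omega
  rw [Fin.sum_univ_eq_sum_range
    (fun i => kraw (4 * N + 2) (2 * i) (oddIdx N j) * kraw (4 * N + 2) (oddIdx N l) (2 * i)),
    kraw_key N _ _ ha (o j) (o l)]
  simp only [oddIdx, Fin.ext_iff, Fin.val_zero]
  split_ifs <;> first | omega | norm_num

theorem phi_aux (k : Type*) [Field k] (hchar : (2 : k) ≠ 0) (N : ℕ) :
    ∃ e : (Fin (N + 1) → k) ≃ₗ[k] (Fin (N + 1) → k),
      ∀ x y : Fin (N + 1) → k,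
        ∑ i : Fin (N + 1), ((4 * N + 2).choose (2 * (i : ℕ)) : k) * e x i * e y i =
          2 * ((4 * N + 2).choose (2 * N + 1) : k) * x 0 * y 0 +
            ∑ i : Fin N, ((4 * N + 2).choose (2 * (i : ℕ) + 1) : k) * x i.succ * y i.succ := by
  set M : Matrix (Fin (N + 1)) (Fin (N + 1)) k :=
    fun i j => (2 ^ (2 * N))⁻¹ * (kraw (4 * N + 2) (oddIdx N j) (2 * i) : k) with hM
  set P : Matrix (Fin (N + 1)) (Fin (N + 1)) k :=
    fun j i => (2 ^ (2 * N))⁻¹ * (kraw (4 * N + 2) (2 * i) (oddIdx N j) : k) with hP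
  have h2 : (2 : k) ^ (2 * N) ≠ 0 := pow_ne_zero _ hchar
  have hPM : P * M = Matrix.diagonal (fun j => if j = 0 then 2 else 1) := by
    ext j l
    rw [Matrix.mul_apply, Matrix.diagonal_apply]
    have h := congrArg (Int.cast : ℤ → k) (kraw_fin N j l)
    push_cast at h
    have : ∀ i, P j i * M i l = (2 ^ (2 * N))⁻¹ * (2 ^ (2 * N))⁻¹ *
      ((kraw (4 * N + 2) (2 * i) (oddIdx N j) : k) * kraw (4 * N + 2) (oddIdx N l) (2 * i)) := by
      intro i; simp only [hM, hP]; ring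
    simp only [this, ← Finset.mul_sum]
    rw [h]
    have h4 : (2 : k) ^ (4 * N) = 2 ^ (2 * N) * 2 ^ (2 * N) := by rw [← pow_add]; congr 1; omega
    rw [h4]
    by_cases hjl : l = j
    · subst hjl; simp; field_simp
    · rw [if_neg hjl, if_neg (Ne.symm hjl), mul_zero]
  have hMP : M.transpose * Matrix.diagonal (fun i : Fin (N + 1) => ((4 * N + 2).choose (2 * (i : ℕ)) : k))
      = Matrix.diagonal (fun j => ((4 * N + 2).choose (oddIdx N j) : k)) * P := by
    ext j i
    rw [Matrix.mul_diagonal, Matrix.diagonal_mul, Matrix.transpose_apply]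
    have hi := i.2
    have hj := j.2
    have h := congrArg (Int.cast : ℤ → k) (kraw_symm (4 * N + 2) (2 * i) (oddIdx N j) (by omega)
      (by rw [oddIdx]; split_ifs <;> omega))
    push_cast at h
    simp only [hM, hP]
    linear_combination (2 ^ (2 * N))⁻¹ * h
  have hinj : Function.Injective (Matrix.mulVecLin M) := by
    intro x y hxy
    have h := congrArg (fun v => P.mulVec v) hxy
    simp only [Matrix.mulVecLin_apply, Matrix.mulVec_mulVec, hPM] at h
    ext j
    have h' := congrFun h j
    rw [Matrix.mulVec_diagonal, Matrix.mulVec_diagonal] at h'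
    refine mul_left_cancel₀ ?_ h'
    split_ifs
    · exact hchar
    · exact one_ne_zero
  refine ⟨LinearEquiv.ofInjectiveEndo _ hinj, fun x y => ?_⟩
  rw [LinearEquiv.coe_ofInjectiveEndo]
  simp only [Matrix.mulVecLin_apply]
  have e1 : ∑ i : Fin (N + 1), ((4 * N + 2).choose (2 * (i : ℕ)) : k) * M.mulVec x i * M.mulVec y i
      = x ⬝ᵥ (M.transpose * Matrix.diagonal
        (fun i : Fin (N + 1) => ((4 * N + 2).choose (2 * (i : ℕ)) : k)) * M).mulVec y := by
    rw [← Matrix.mulVec_mulVec, ← Matrix.mulVec_mulVec, Matrix.dotProduct_mulVec,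
      Matrix.vecMul_transpose, dotProduct]
    apply Finset.sum_congr rfl
    intro i _
    rw [Matrix.mulVec_diagonal]; ring
  rw [e1, hMP, Matrix.mul_assoc, hPM, Matrix.diagonal_mul_diagonal, dotProduct, Fin.sum_univ_succ]
  simp only [Matrix.mulVec_diagonal]
  congr 1
  · simp [oddIdx]; ring
  · apply Finset.sum_congr rfl
    intro i _
    have : oddIdx N i.succ = 2 * (i : ℕ) + 1 := by
      simp [oddIdx]; omega
    rw [this, if_neg (Fin.succ_ne_zero i)]; ring


/-- Theorem B, case `n ≡ 2 (mod 4)`: over a field of characteristic ≠ 2, the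
diagonal symmetric bilinear form `⟨C(n,m) : 0 ≤ m < n/2, m even⟩` is isomorphic
to `⟨2·C(n,n/2)⟩ ⊕ ⟨C(n,m) : 0 ≤ m < n/2, m odd⟩`. Both sides have dimension
`n/4 + 1` (note `n/4 = (n-2)/4` in natural division). -/
theorem phi_even_iso_two_mod_four (k : Type*) [Field k]
    (hchar : (2 : k) ≠ 0) (n : ℕ) (hn : n % 4 = 2) :
    ∃ e : (Fin (n / 4 + 1) → k) ≃ₗ[k] (Fin (n / 4 + 1) → k),
      ∀ x y : Fin (n / 4 + 1) → k,
        ∑ i : Fin (n / 4 + 1), (n.choose (2 * (i : ℕ)) : k) * e x i * e y i =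
          2 * (n.choose (n / 2) : k) * x 0 * y 0 +
            ∑ i : Fin (n / 4), (n.choose (2 * (i : ℕ) + 1) : k) * x i.succ * y i.succ := by
  obtain ⟨N, rfl⟩ : ∃ N, n = 4 * N + 2 := ⟨n / 4, by omega⟩
  have h1 : (4 * N + 2) / 4 = N := by omega
  have h2 : (4 * N + 2) / 2 = 2 * N + 1 := by omega
  rw [h1, h2]
  exact phi_aux k hchar N
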